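/- arXiv:math/0210375 — 2 statements merged into one kernel-verified Lean document; each statement's English description precedes it below -/
import Mathlib

section
/- Let m, n, k, r be non-negative integers with k ≤ min(m−2, n−2), r ≥ 1 and r < min(m−k, n). Let Y = {(i,j) ∈ ℤ×ℤ : 1 ≤ i ≤ m, 1 ≤ j ≤ min(n, n+m−k−i)} be the one-sided diagonal ladder, and set P_i = (i, n) and Q_i = (m, i) for i = 1, …, r. Then the number of r-tuples of non-intersecting paths in Y from P_1, …, P_r to Q_1, …, Q_r equals det[ C(m+n−i−j, m−i) − C(m+n−i−j, k−1) ]_{i,j=1,…,r}. (By the paper's Corollary 4.2, this number is the multiplicity of the one-sided ladder determinantal ring K[Y]/I_{r+1}(Y).) -/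
/-- A (lattice) path in `Y` from `P` to `Q`: a nonempty finite sequence of points of `Y`
starting at `P`, ending at `Q`, each step either increases the first coordinate by 1 or
decreases the second coordinate by 1. -/
def LPath (Y : Set (ℤ × ℤ)) (P Q : ℤ × ℤ) (c : List (ℤ × ℤ)) : Prop :=
  c.head? = some P ∧ c.getLast? = some Q ∧ (∀ p ∈ c, p ∈ Y) ∧
  List.Chain' (fun p q : ℤ × ℤ => q = (p.1 + 1, p.2) ∨ q = (p.1, p.2 - 1)) c

/-- `w(P,Q)`: the number of paths in `Y` from `P` to `Q`. -/
noncomputable def pathCount (Y : Set (ℤ × ℤ)) (P Q : ℤ × ℤ) : ℕ :=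
  Nat.card {c : List (ℤ × ℤ) // LPath Y P Q c}

/-- The number of `r`-tuples of pairwise non-intersecting paths in `Y` from `P i` to `Q i`. -/
noncomputable def nipCount (Y : Set (ℤ × ℤ)) {r : ℕ} (P Q : Fin r → ℤ × ℤ) : ℕ :=
  Nat.card {C : Fin r → List (ℤ × ℤ) //
    (∀ i, LPath Y (P i) (Q i) (C i)) ∧
    ∀ i j, i ≠ j → ∀ p ∈ C i, p ∉ C j}

/-- The binomial coefficient `C(N, x)` for integers, with the convention that it is `0`
when `N < 0`, `x < 0`, or `x > N`. -/
def ibinom (N x : ℤ) : ℤ :=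
  if 0 ≤ N ∧ 0 ≤ x then (N.toNat.choose x.toNat : ℤ) else 0

/-- The index set `T = {(a,b) : a − b = 0 or a − b = 1}`. -/
def Tset : Set (ℤ × ℤ) := {p : ℤ × ℤ | p.1 - p.2 = 0 ∨ p.1 - p.2 = 1}

/-- Recursive description of the paths issuing from a point, according to their first step. -/
theorem lPath_cons_iff {Y : Set (ℤ × ℤ)} {P Q p : ℤ × ℤ} {c : List (ℤ × ℤ)} :
    LPath Y P Q (p :: c) ↔ p = P ∧ P ∈ Y ∧
      ((c = [] ∧ P = Q) ∨ LPath Y (P.1 + 1, P.2) Q c ∨ LPath Y (P.1, P.2 - 1) Q c) := by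
  cases c with
  | nil =>
    simp only [LPath, List.head?_cons, Option.some.injEq, List.getLast?_singleton,
      List.mem_singleton, forall_eq, List.Chain', List.isChain_singleton, and_true,
      List.head?_nil, reduceCtorEq, false_and, or_false, true_and]
    constructor
    · rintro ⟨rfl, h, hY⟩; exact ⟨rfl, hY, h⟩
    · rintro ⟨rfl, hY, h⟩; exact ⟨rfl, h, hY⟩
  | cons q c =>
    simp only [LPath, List.head?_cons, Option.some.injEq, List.getLast?_cons_cons,
      List.mem_cons, forall_eq_or_imp, List.Chain', List.isChain_cons_cons, reduceCtorEq,
      false_and, false_or]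
    constructor
    · rintro ⟨rfl, hl, ⟨hp, hq⟩, h | h, hc⟩
      · exact ⟨rfl, hp, Or.inl ⟨h, hl, hq, hc⟩⟩
      · exact ⟨rfl, hp, Or.inr ⟨h, hl, hq, hc⟩⟩
    · rintro ⟨rfl, hp, ⟨h, hl, hq, hc⟩ | ⟨h, hl, hq, hc⟩⟩
      · exact ⟨rfl, hl, ⟨hp, hq⟩, Or.inl h, hc⟩
      · exact ⟨rfl, hl, ⟨hp, hq⟩, Or.inr h, hc⟩

theorem not_lPath_nil {Y : Set (ℤ × ℤ)} {P Q : ℤ × ℤ} : ¬ LPath Y P Q [] := by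
  simp [LPath]

theorem LPath.exists_cons {Y : Set (ℤ × ℤ)} {P Q : ℤ × ℤ} {c : List (ℤ × ℤ)}
    (h : LPath Y P Q c) : ∃ d, c = P :: d := by
  cases c with
  | nil => exact absurd h not_lPath_nil
  | cons p d => exact ⟨d, by rw [(lPath_cons_iff.1 h).1]⟩

theorem LPath.mem_left {Y : Set (ℤ × ℤ)} {P Q : ℤ × ℤ} {c : List (ℤ × ℤ)}
    (h : LPath Y P Q c) : P ∈ c := by
  obtain ⟨d, rfl⟩ := h.exists_cons
  exact List.mem_cons_self

theorem LPath.left_mem {Y : Set (ℤ × ℤ)} {P Q : ℤ × ℤ} {c : List (ℤ × ℤ)}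
    (h : LPath Y P Q c) : P ∈ Y :=
  h.2.2.1 P h.mem_left

theorem LPath.right_mem {Y : Set (ℤ × ℤ)} {P Q : ℤ × ℤ} {c : List (ℤ × ℤ)}
    (h : LPath Y P Q c) : Q ∈ Y :=
  h.2.2.1 Q (List.mem_of_getLast? h.2.1)

/-- Every point of a path other than its starting point lies strictly later. -/
theorem LPath.eq_or_lt_of_mem {Y : Set (ℤ × ℤ)} {Q : ℤ × ℤ} {c : List (ℤ × ℤ)} :
    ∀ {P q : ℤ × ℤ}, LPath Y P Q c → q ∈ c → q = P ∨ q.2 - q.1 < P.2 - P.1 := by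
  induction c with
  | nil => intro P q h; exact absurd h not_lPath_nil
  | cons p c ih =>
    intro P q h hq
    obtain ⟨rfl, -, h⟩ := lPath_cons_iff.1 h
    rcases List.mem_cons.1 hq with rfl | hq
    · exact Or.inl rfl
    · right
      rcases h with ⟨rfl, -⟩ | h | h
      · simp at hq
      all_goals
        rcases ih h hq with rfl | h'
        · simp
        · simp only at h'; omega

/-- Paths descend in the second coordinate. -/
theorem LPath.snd_le {Y : Set (ℤ × ℤ)} {Q : ℤ × ℤ} {c : List (ℤ × ℤ)} :
    ∀ {P : ℤ × ℤ}, LPath Y P Q c → Q.2 ≤ P.2 := by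
  induction c with
  | nil => intro P h; exact absurd h not_lPath_nil
  | cons p c ih =>
    intro P h
    obtain ⟨rfl, -, ⟨-, rfl⟩ | h | h⟩ := lPath_cons_iff.1 h
    · exact le_rfl
    all_goals
      have := ih h
      simp only at this
      omega

/-- Two paths ending in the last column cross if the one that starts to the lower left of the
other ends above it. -/
theorem LPath.exists_common_point {Y : Set (ℤ × ℤ)} {m u v : ℤ} (hY : ∀ p ∈ Y, p.1 ≤ m)
    (huv : v < u) (N : ℕ) : ∀ {p q : ℤ × ℤ} {c d : List (ℤ × ℤ)}, c.length + d.length ≤ N →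
      LPath Y p (m, u) c → LPath Y q (m, v) d → p.1 ≤ q.1 → p.2 ≤ q.2 →
      ∃ x ∈ c, x ∈ d := by
  induction N with
  | zero =>
    intro p q c d hN hc
    obtain ⟨c, rfl⟩ := hc.exists_cons
    simp at hN
  | succ N ih =>
    intro p q c d hN hc hd h1 h2
    have hq := hY q hd.left_mem
    by_cases hpq : p = q
    · exact ⟨p, hc.mem_left, hpq ▸ hd.mem_left⟩
    rcases h1.lt_or_eq with h1 | h1
    · obtain ⟨c, rfl⟩ := hc.exists_cons
      have hl : c.length + d.length ≤ N := by simp only [List.length_cons] at hN; omega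
      obtain ⟨-, -, ⟨-, rfl⟩ | hc | hc⟩ := lPath_cons_iff.1 hc
      · simp only at h1; omega
      · obtain ⟨x, hx, hx'⟩ := ih hl hc hd (by simp only; omega) h2
        exact ⟨x, List.mem_cons_of_mem _ hx, hx'⟩
      · obtain ⟨x, hx, hx'⟩ := ih hl hc hd (by simp only; omega) (by simp only; omega)
        exact ⟨x, List.mem_cons_of_mem _ hx, hx'⟩
    · have h2 : p.2 < q.2 := lt_of_le_of_ne h2 fun h => hpq (Prod.ext h1 h)
      have hu := hc.snd_le
      obtain ⟨d, rfl⟩ := hd.exists_cons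
      have hl : c.length + d.length ≤ N := by simp only [List.length_cons] at hN; omega
      obtain ⟨-, -, ⟨-, rfl⟩ | hd | hd⟩ := lPath_cons_iff.1 hd
      · simp only at h2 hu; omega
      · obtain ⟨x, hx, hx'⟩ := ih hl hc hd (by simp only; omega) (by simp only; omega)
        exact ⟨x, hx, List.mem_cons_of_mem _ hx'⟩
      · obtain ⟨x, hx, hx'⟩ := ih hl hc hd (by simp only; omega) (by simp only; omega)
        exact ⟨x, hx, List.mem_cons_of_mem _ hx'⟩

/-- The paths from a state to the sink `Q j`: a state is either a point of the plane, or the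
index of a sink that has been reached, from which only the empty path remains. -/
def statePaths (Y : Set (ℤ × ℤ)) {r : ℕ} (Q : Fin r → ℤ × ℤ) (j : Fin r) :
    (ℤ × ℤ) ⊕ Fin r → Set (List (ℤ × ℤ))
  | Sum.inl p => {c | LPath Y p (Q j) c}
  | Sum.inr l => {c | l = j ∧ c = []}

/-- The states that may follow a point `p`. -/
def nextStates {r : ℕ} (Q : Fin r → ℤ × ℤ) (p : ℤ × ℤ) : Finset ((ℤ × ℤ) ⊕ Fin r) :=
  {Sum.inl (p.1 + 1, p.2), Sum.inl (p.1, p.2 - 1)} ∪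
    (Finset.univ.filter fun l => p = Q l).map Function.Embedding.inr

theorem cons_mem_statePaths_iff {Y : Set (ℤ × ℤ)} {r : ℕ} {Q : Fin r → ℤ × ℤ} {j : Fin r}
    {p q : ℤ × ℤ} {c : List (ℤ × ℤ)} :
    q :: c ∈ statePaths Y Q j (Sum.inl p) ↔
      q = p ∧ p ∈ Y ∧ ∃ v ∈ nextStates Q p, c ∈ statePaths Y Q j v := by
  simp only [statePaths, Set.mem_ofPred_eq, lPath_cons_iff, nextStates, Finset.mem_union,
    Finset.mem_insert, Finset.mem_singleton, Finset.mem_map, Finset.mem_filter,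
    Finset.mem_univ, true_and, Function.Embedding.inr_apply, or_and_right, exists_or,
    exists_eq_left]
  refine and_congr_right fun _ => and_congr_right fun _ => ?_
  constructor
  · rintro (⟨h, h'⟩ | h | h)
    · exact Or.inr ⟨_, ⟨j, h', rfl⟩, rfl, h⟩
    · exact Or.inl (Or.inl h)
    · exact Or.inl (Or.inr h)
  · rintro ((h | h) | ⟨_, ⟨l, h', rfl⟩, rfl, h⟩)
    · exact Or.inr (Or.inl h)
    · exact Or.inr (Or.inr h)
    · exact Or.inl ⟨h, h'⟩

theorem eq_of_mem_statePaths {Y : Set (ℤ × ℤ)} {r : ℕ} {Q : Fin r → ℤ × ℤ} {j : Fin r}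
    {c : List (ℤ × ℤ)} : ∀ {v w : (ℤ × ℤ) ⊕ Fin r},
    c ∈ statePaths Y Q j v → c ∈ statePaths Y Q j w → v = w
  | Sum.inl p, Sum.inl q, h, h' => by
    have := h.1.symm.trans h'.1
    simp_all
  | Sum.inl p, Sum.inr l, h, h' => by
    rw [h'.2] at h
    exact absurd h not_lPath_nil
  | Sum.inr l, Sum.inl p, h, h' => by
    rw [h.2] at h'
    exact absurd h' not_lPath_nil
  | Sum.inr l, Sum.inr l', h, h' => by rw [h.1, h'.1]

/-- The tuples of non-intersecting paths from the states `s i` to the sinks `Q (σ i)`. -/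
def nipTuples (Y : Set (ℤ × ℤ)) {r : ℕ} (Q : Fin r → ℤ × ℤ) (σ : Fin r → Fin r)
    (s : Fin r → (ℤ × ℤ) ⊕ Fin r) : Set (Fin r → List (ℤ × ℤ)) :=
  {C | (∀ i, C i ∈ statePaths Y Q (σ i) (s i)) ∧ ∀ i j, i ≠ j → ∀ p ∈ C i, p ∉ C j}

/-- Decomposition of non-intersecting tuples according to the first step of a path whose
starting point is at least as early as all the others. -/
theorem nipTuples_eq_iUnion {Y : Set (ℤ × ℤ)} {r : ℕ} {Q : Fin r → ℤ × ℤ} {σ : Fin r → Fin r}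
    {s : Fin r → (ℤ × ℤ) ⊕ Fin r} {i : Fin r} {p : ℤ × ℤ} (hi : s i = Sum.inl p) (hp : p ∈ Y)
    (hmax : ∀ j q, j ≠ i → s j = Sum.inl q → q ≠ p ∧ q.2 - q.1 ≤ p.2 - p.1) :
    nipTuples Y Q σ s = ⋃ v ∈ nextStates Q p,
      (fun C => Function.update C i (p :: C i)) '' nipTuples Y Q σ (Function.update s i v) := by
  ext C
  simp only [Set.mem_iUnion, Set.mem_image, exists_prop]
  constructor
  · rintro ⟨hC, hdis⟩
    have hCi := hC i
    rw [hi] at hCi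
    obtain ⟨c, hc⟩ := LPath.exists_cons hCi
    rw [hc, cons_mem_statePaths_iff] at hCi
    obtain ⟨-, -, v, hv, hcv⟩ := hCi
    have hsub : ∀ j, ∀ q ∈ Function.update C i c j, q ∈ C j := by
      intro j q hq
      rcases eq_or_ne j i with rfl | hj
      · rw [Function.update_self] at hq
        rw [hc]
        exact List.mem_cons_of_mem _ hq
      · rwa [Function.update_of_ne hj] at hq
    refine ⟨v, hv, Function.update C i c, ⟨fun j => ?_, fun j l hjl q hq hq' => ?_⟩, ?_⟩
    · rcases eq_or_ne j i with rfl | hj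
      · simpa using hcv
      · simpa [Function.update_of_ne hj] using hC j
    · exact hdis j l hjl q (hsub j q hq) (hsub l q hq')
    · simp [← hc]
  · rintro ⟨v, hv, C, ⟨hC, hdis⟩, rfl⟩
    have hnot : ∀ j, j ≠ i → p ∉ C j := by
      intro j hj hpj
      have h := hC j
      rw [Function.update_of_ne hj] at h
      cases hs : s j with
      | inl q =>
        rw [hs] at h
        obtain ⟨h1, h2⟩ := hmax j q hj hs
        rcases LPath.eq_or_lt_of_mem h hpj with h3 | h3
        · exact h1 h3.symm
        · omega
      | inr l =>
        rw [hs] at h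
        rw [h.2] at hpj
        simp at hpj
    refine ⟨fun j => ?_, fun j l hjl q hq hq' => ?_⟩
    · have h := hC j
      rcases eq_or_ne j i with rfl | hj
      · rw [Function.update_self] at h
        simp only [Function.update_self, hi, cons_mem_statePaths_iff]
        exact ⟨trivial, hp, v, hv, h⟩
      · simpa [Function.update_of_ne hj] using h
    · rcases eq_or_ne j i with rfl | hj
      · rw [Function.update_self] at hq
        rw [Function.update_of_ne hjl.symm] at hq'
        rcases List.mem_cons.1 hq with rfl | hq
        · exact hnot l hjl.symm hq'
        · exact hdis j l hjl q hq hq'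
      · rw [Function.update_of_ne hj] at hq
        rcases eq_or_ne l i with rfl | hl
        · rw [Function.update_self] at hq'
          rcases List.mem_cons.1 hq' with rfl | hq'
          · exact hnot j hj hq
          · exact hdis j l hjl q hq hq'
        · rw [Function.update_of_ne hl] at hq'
          exact hdis j l hjl q hq hq'

theorem Matrix.det_updateRow_finset_sum {n ι R : Type*} [Fintype n] [DecidableEq n] [CommRing R]
    (M : Matrix n n R) (i : n) (t : Finset ι) (f : ι → n → R) :
    (M.updateRow i (∑ v ∈ t, f v)).det = ∑ v ∈ t, (M.updateRow i (f v)).det := by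
  classical
  induction t using Finset.induction_on with
  | empty => exact (M.updateRow i 0).det_eq_zero_of_row_eq_zero i (by simp)
  | insert a t ha ih =>
    rw [Finset.sum_insert ha, Finset.sum_insert ha, Matrix.det_updateRow_add, ih]

/-- A termination measure on states: it drops with every step. -/
def stateHeight (m : ℤ) {r : ℕ} : (ℤ × ℤ) ⊕ Fin r → ℕ
  | Sum.inl p => (m + 1 - p.1).toNat + p.2.toNat + 1
  | Sum.inr _ => 0

theorem stateHeight_lt {m : ℤ} {r : ℕ} {Q : Fin r → ℤ × ℤ} {p : ℤ × ℤ} (h1 : p.1 ≤ m)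
    (h2 : 1 ≤ p.2) {v : (ℤ × ℤ) ⊕ Fin r} (hv : v ∈ nextStates Q p) :
    stateHeight m v < stateHeight m (Sum.inl p : (ℤ × ℤ) ⊕ Fin r) := by
  simp only [nextStates, Finset.mem_union, Finset.mem_insert, Finset.mem_singleton,
    Finset.mem_map, Function.Embedding.inr_apply] at hv
  rcases hv with (rfl | rfl) | ⟨l, -, rfl⟩ <;> simp only [stateHeight] <;> omega

/-- Lindström–Gessel–Viennot: the determinant of a solution `W` of the recursion for path counts
is the signed count of non-intersecting tuples. -/
theorem finite_nipTuples_and_det_eq {Y : Set (ℤ × ℤ)} {r : ℕ} {Q : Fin r → ℤ × ℤ} {m : ℤ}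
    (hY : ∀ p ∈ Y, p.1 ≤ m ∧ 1 ≤ p.2) (W : (ℤ × ℤ) ⊕ Fin r → Fin r → ℤ)
    (hW : ∀ p ∈ Y, W (Sum.inl p) = ∑ v ∈ nextStates Q p, W v)
    (hW_out : ∀ p ∉ Y, W (Sum.inl p) = 0)
    (hW_sink : ∀ l j, W (Sum.inr l) j = if l = j then 1 else 0) (N : ℕ) :
    ∀ s : Fin r → (ℤ × ℤ) ⊕ Fin r, ∑ i, stateHeight m (s i) ≤ N →
      (∀ σ : Fin r → Fin r, (nipTuples Y Q σ s).Finite) ∧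
      (Matrix.of fun i => W (s i)).det =
        ∑ σ : Equiv.Perm (Fin r), (Equiv.Perm.sign σ : ℤ) * (nipTuples Y Q σ s).ncard := by
  induction N using Nat.strong_induction_on with
  | _ N ih =>
  intro s hN
  by_cases hout : ∃ i p, s i = Sum.inl p ∧ p ∉ Y
  · obtain ⟨i, p, hi, hp⟩ := hout
    have h0 : ∀ σ : Fin r → Fin r, nipTuples Y Q σ s = ∅ := by
      intro σ
      rw [Set.eq_empty_iff_forall_notMem]
      rintro C ⟨hC, -⟩
      have := hC i
      rw [hi] at this
      exact hp (LPath.left_mem this)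
    refine ⟨fun σ => by simp [h0], ?_⟩
    rw [Matrix.det_eq_zero_of_row_eq_zero i (by simp [hi, hW_out p hp])]
    simp [h0]
  have hin : ∀ i p, s i = Sum.inl p → p ∈ Y := by
    intro i p h
    by_contra hp
    exact hout ⟨i, p, h, hp⟩
  by_cases hcoinc : ∃ i j p, i ≠ j ∧ s i = Sum.inl p ∧ s j = Sum.inl p
  · obtain ⟨i, j, p, hij, hi, hj⟩ := hcoinc
    have h0 : ∀ σ : Fin r → Fin r, nipTuples Y Q σ s = ∅ := by
      intro σ
      rw [Set.eq_empty_iff_forall_notMem]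
      rintro C ⟨hC, hdis⟩
      have h1 := hC i
      have h2 := hC j
      rw [hi] at h1
      rw [hj] at h2
      exact hdis i j hij p (LPath.mem_left h1) (LPath.mem_left h2)
    refine ⟨fun σ => by simp [h0], ?_⟩
    rw [Matrix.det_zero_of_row_eq hij (by ext; simp [hi, hj])]
    simp [h0]
  by_cases hpt : ∃ i p, s i = Sum.inl p
  · obtain ⟨i₀, p₀, hi₀⟩ := hpt
    obtain ⟨i, -, hmax⟩ := Finset.exists_max_image Finset.univ (fun i => stateHeight m (s i))
      ⟨i₀, Finset.mem_univ _⟩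
    cases hi : s i with
    | inr l =>
      have := hmax i₀ (Finset.mem_univ _)
      simp [hi, hi₀, stateHeight] at this
    | inl p =>
    have hp := hin i p hi
    have hmax' : ∀ j q, j ≠ i → s j = Sum.inl q → q ≠ p ∧ q.2 - q.1 ≤ p.2 - p.1 := by
      intro j q hj hq
      refine ⟨?_, ?_⟩
      · rintro rfl
        exact hcoinc ⟨j, i, q, hj, hq, hi⟩
      · have h1 := hmax j (Finset.mem_univ _)
        have h2 := hY q (hin j q hq)
        have h3 := hY p hp
        simp only [hq, hi, stateHeight] at h1
        omega
    have hdec : ∀ v ∈ nextStates Q p, ∑ j, stateHeight m (Function.update s i v j) < N := by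
      intro v hv
      refine lt_of_lt_of_le (Finset.sum_lt_sum (fun j _ => ?_) ⟨i, Finset.mem_univ _, ?_⟩) hN
      · rcases eq_or_ne j i with rfl | hj
        · rw [Function.update_self, hi]
          exact (stateHeight_lt (hY p hp).1 (hY p hp).2 hv).le
        · rw [Function.update_of_ne hj]
      · rw [Function.update_self, hi]
        exact stateHeight_lt (hY p hp).1 (hY p hp).2 hv
    have hrec := fun v hv => ih _ (hdec v hv) (Function.update s i v) le_rfl
    have hinj : Function.Injective
        fun C : Fin r → List (ℤ × ℤ) => Function.update C i (p :: C i) := by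
      intro C D h
      ext1 j
      have := congrFun h j
      rcases eq_or_ne j i with rfl | hj
      · simpa using this
      · simpa [Function.update_of_ne hj] using this
    have hfin : ∀ σ : Fin r → Fin r, ∀ v ∈ nextStates Q p,
        ((fun C : Fin r → List (ℤ × ℤ) => Function.update C i (p :: C i)) ''
          nipTuples Y Q σ (Function.update s i v)).Finite :=
      fun σ v hv => ((hrec v hv).1 σ).image _
    refine ⟨fun σ => ?_, ?_⟩
    · rw [nipTuples_eq_iUnion hi hp hmax']
      exact (nextStates Q p).finite_toSet.biUnion (hfin σ)
    · have hrow : (Matrix.of fun j => W (s j)) =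
          (Matrix.of fun j => W (s j)).updateRow i (∑ v ∈ nextStates Q p, W v) := by
        rw [← hW p hp, ← hi]
        exact (Matrix.updateRow_eq_self (Matrix.of fun j => W (s j)) i).symm
      have hupd : ∀ v, (Matrix.of fun j => W (s j)).updateRow i (W v) =
          Matrix.of fun j => W (Function.update s i v j) := by
        intro v
        ext j l
        rcases eq_or_ne j i with rfl | hj
        · simp
        · simp [hj]
      rw [hrow, Matrix.det_updateRow_finset_sum]
      simp_rw [hupd]
      rw [Finset.sum_congr rfl fun v hv => (hrec v hv).2, Finset.sum_comm]
      refine Finset.sum_congr rfl fun σ _ => ?_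
      have hdisj : (nextStates Q p : Set ((ℤ × ℤ) ⊕ Fin r)).PairwiseDisjoint fun v =>
          (fun C : Fin r → List (ℤ × ℤ) => Function.update C i (p :: C i)) ''
            nipTuples Y Q σ (Function.update s i v) := by
        intro v _ w _ hvw
        rw [Function.onFun, Set.disjoint_image_iff hinj, Set.disjoint_left]
        rintro C ⟨hC, -⟩ ⟨hC', -⟩
        have h1 := hC i
        have h2 := hC' i
        rw [Function.update_self] at h1 h2
        exact hvw (eq_of_mem_statePaths h1 h2)
      have hcard := (nextStates Q p).finite_toSet.ncard_biUnion (hfin σ) hdisj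
      rw [finsum_mem_coe_finset] at hcard
      simp_rw [Set.ncard_image_of_injective _ hinj] at hcard
      rw [nipTuples_eq_iUnion hi hp hmax', ← Finset.mul_sum, ← Nat.cast_sum, ← hcard]
      rfl
  · have hsink : ∀ i, ∃ l, s i = Sum.inr l := by
      intro i
      cases h : s i with
      | inl p => exact absurd ⟨i, p, h⟩ hpt
      | inr l => exact ⟨l, rfl⟩
    choose f hf using hsink
    have hT : ∀ σ : Fin r → Fin r,
        nipTuples Y Q σ s = if ∀ i, f i = σ i then {fun _ => []} else ∅ := by
      intro σ
      split_ifs with h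
      · ext C
        simp [nipTuples, hf, statePaths, h, funext_iff]
        grind
      · rw [Set.eq_empty_iff_forall_notMem]
        rintro C ⟨hC, -⟩
        refine h fun i => ?_
        have := hC i
        rw [hf] at this
        exact this.1
    refine ⟨fun σ => ?_, ?_⟩
    · rw [hT]
      split_ifs <;> simp
    · rw [← Matrix.det_transpose, Matrix.det_apply']
      refine Finset.sum_congr rfl fun σ _ => ?_
      congr 1
      simp only [Matrix.transpose_apply, Matrix.of_apply, hf, hW_sink]
      rw [hT, Fintype.prod_ite_zero]
      split_ifs <;> simp

theorem ibinom_of_neg {N x : ℤ} (h : N < 0 ∨ x < 0) : ibinom N x = 0 := by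
  rw [ibinom, if_neg]
  omega

theorem ibinom_eq_zero_of_lt {N x : ℤ} (h : N < x) : ibinom N x = 0 := by
  rw [ibinom]
  split_ifs with h'
  · rw [Nat.choose_eq_zero_of_lt (by omega), Nat.cast_zero]
  · rfl

theorem ibinom_zero_left {x : ℤ} : ibinom 0 x = if x = 0 then 1 else 0 := by
  rcases lt_trichotomy x 0 with h | rfl | h
  · rw [ibinom_of_neg (Or.inr h), if_neg h.ne]
  · simp [ibinom]
  · rw [ibinom_eq_zero_of_lt h, if_neg h.ne']

theorem ibinom_pascal {N x : ℤ} (hN : N ≠ 0) :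
    ibinom N x = ibinom (N - 1) (x - 1) + ibinom (N - 1) x := by
  rcases lt_or_gt_of_ne hN with hN | hN
  · rw [ibinom_of_neg (by omega), ibinom_of_neg (by omega), ibinom_of_neg (by omega), add_zero]
  rcases lt_trichotomy x 0 with h | rfl | h
  · rw [ibinom_of_neg (by omega), ibinom_of_neg (by omega), ibinom_of_neg (by omega), add_zero]
  · rw [ibinom_of_neg (N := N - 1) (x := 0 - 1) (by omega)]
    simp [ibinom, hN.le, show 1 ≤ N by omega]
  · obtain ⟨a, rfl⟩ : ∃ a : ℕ, N = a + 1 := ⟨(N - 1).toNat, by omega⟩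
    obtain ⟨b, rfl⟩ : ∃ b : ℕ, x = b + 1 := ⟨(x - 1).toNat, by omega⟩
    have e1 : ((a : ℤ) + 1).toNat = a + 1 := by omega
    have e2 : ((b : ℤ) + 1).toNat = b + 1 := by omega
    simp only [ibinom, add_sub_cancel_right, e1, e2, Int.toNat_natCast]
    rw [if_pos (by omega), if_pos (by omega), if_pos (by omega), Nat.choose_succ_succ]
    push_cast
    rfl

/-- A permutation of `Fin r` other than the identity has an inversion. -/
theorem Equiv.Perm.exists_inversion {r : ℕ} {σ : Equiv.Perm (Fin r)} (h : σ ≠ 1) :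
    ∃ i j, i < j ∧ σ j < σ i := by
  by_contra! H
  have hmono : StrictMono σ := fun i j hij =>
    lt_of_le_of_ne (H i j hij) fun e => hij.ne (σ.injective e)
  refine h (Equiv.ext fun i => ?_)
  exact congrFun (hmono.range_inj strictMono_id |>.1 (by simp)) i

/-- The number of lattice paths from `p` to `(m, j)` below the line `x + y = n + m - k + 1`, by
reflection in that line. -/
def reflectedCount (m n k : ℤ) (p : ℤ × ℤ) (j : ℤ) : ℤ :=
  ibinom (m - p.1 + p.2 - j) (m - p.1) - ibinom (m - p.1 + p.2 - j) (p.2 + k - n - 1)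

theorem reflectedCount_eq_zero {m n k j : ℤ} {p : ℤ × ℤ} (hk : k ≤ n) (hj : 1 ≤ j)
    (hp : (p.1 = m + 1 ∧ p.2 ≤ n - k) ∨ p.2 = 0 ∨ p.1 + p.2 = n + m - k + 1) :
    reflectedCount m n k p j = 0 := by
  rw [reflectedCount]
  rcases hp with ⟨h1, h2⟩ | h | h
  · rw [ibinom_of_neg (Or.inr (by omega)), ibinom_of_neg (Or.inr (by omega)), sub_zero]
  · rw [ibinom_eq_zero_of_lt (by omega), ibinom_of_neg (Or.inr (by omega)), sub_zero]
  · rw [show m - p.1 = p.2 + k - n - 1 by omega, sub_self]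

theorem reflectedCount_rec {m n k j : ℤ} {p : ℤ × ℤ} (hj : j ≤ n - k)
    (hp : p.1 + p.2 ≤ n + m - k) :
    reflectedCount m n k p j = reflectedCount m n k (p.1 + 1, p.2) j +
      reflectedCount m n k (p.1, p.2 - 1) j + if p = (m, j) then 1 else 0 := by
  simp only [reflectedCount]
  by_cases h0 : m - p.1 + p.2 - j = 0
  · rw [h0, ibinom_zero_left, ibinom_zero_left, if_neg (by omega : ¬ p.2 + k - n - 1 = 0),
      ibinom_of_neg (Or.inl (by omega)), ibinom_of_neg (Or.inl (by omega)),
      ibinom_of_neg (Or.inl (by omega)), ibinom_of_neg (Or.inl (by omega))]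
    have : m - p.1 = 0 ↔ p = (m, j) := by
      rw [Prod.ext_iff]
      simp only
      omega
    simp [this]
  · rw [ibinom_pascal h0, ibinom_pascal (x := p.2 + k - n - 1) h0, if_neg]
    · rw [show m - (p.1 + 1) + p.2 - j = m - p.1 + p.2 - j - 1 by ring,
        show m - p.1 + (p.2 - 1) - j = m - p.1 + p.2 - j - 1 by ring,
        show m - (p.1 + 1) = m - p.1 - 1 by ring,
        show p.2 - 1 + k - n - 1 = p.2 + k - n - 1 - 1 by ring]
      ring
    · rintro rfl
      simp at h0

theorem stmt15 (m n k : ℤ) (r : ℕ) (hk0 : 0 ≤ k)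
    (hk : k ≤ min (m - 2) (n - 2))
    (hr : 1 ≤ r) (hrm : (r : ℤ) < min (m - k) n)
    (Y : Set (ℤ × ℤ))
    (hY : Y = {p : ℤ × ℤ | 1 ≤ p.1 ∧ p.1 ≤ m ∧
      1 ≤ p.2 ∧ p.2 ≤ min n (n + m - k - p.1)}) :
    (nipCount Y (fun i : Fin r => (((i : ℕ) : ℤ) + 1, n))
        (fun i : Fin r => (m, ((i : ℕ) : ℤ) + 1)) : ℤ) =
      Matrix.det (Matrix.of fun i j : Fin r =>
        ibinom (m + n - (((i : ℕ) : ℤ) + 1) - (((j : ℕ) : ℤ) + 1))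
            (m - (((i : ℕ) : ℤ) + 1)) -
          ibinom (m + n - (((i : ℕ) : ℤ) + 1) - (((j : ℕ) : ℤ) + 1)) (k - 1)) := by
  have hYm : ∀ p, p ∈ Y ↔ 1 ≤ p.1 ∧ p.1 ≤ m ∧ 1 ≤ p.2 ∧ p.2 ≤ n ∧ p.2 ≤ n + m - k - p.1 := by
    intro p
    rw [hY, Set.mem_ofPred_eq, le_min_iff]
  have hk1 : k ≤ m - 2 := hk.trans (min_le_left _ _)
  have hk2 : k ≤ n - 2 := hk.trans (min_le_right _ _)
  have hr1 : (r : ℤ) < m - k := hrm.trans_le (min_le_left _ _)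
  have hcount : nipCount Y (fun i : Fin r => (((i : ℕ) : ℤ) + 1, n))
      (fun i : Fin r => (m, ((i : ℕ) : ℤ) + 1)) =
      (nipTuples Y (fun i : Fin r => (m, ((i : ℕ) : ℤ) + 1)) (1 : Equiv.Perm (Fin r))
        fun i => Sum.inl (((i : ℕ) : ℤ) + 1, n)).ncard := rfl
  rw [hcount]
  by_cases hrk : n - k < r
  · let j : Fin r := ⟨(n - k).toNat, by omega⟩
    have hj : ((j : ℕ) : ℤ) = n - k := Int.toNat_of_nonneg (by omega)
    rw [Matrix.det_eq_zero_of_column_eq_zero j, Nat.cast_eq_zero]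
    · rw [← Set.ncard_empty (Fin r → List (ℤ × ℤ))]
      congr 1
      rw [Set.eq_empty_iff_forall_notMem]
      rintro C ⟨hC, -⟩
      have := (hYm _).1 (LPath.right_mem (hC j))
      simp only [Equiv.Perm.coe_one, id_eq] at this
      omega
    · intro i
      have hi := i.isLt
      rw [Matrix.of_apply, hj, sub_eq_zero]
      simp only [ibinom]
      rcases hk0.eq_or_lt with rfl | hk0
      · rw [if_neg (by omega), if_neg (by omega)]
      · rw [if_pos (by omega), if_pos (by omega)]
        congr 1
        exact Nat.choose_symm_of_eq_add (by omega)
  push Not at hrk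
  classical
  let Q : Fin r → ℤ × ℤ := fun i => (m, ((i : ℕ) : ℤ) + 1)
  let W : (ℤ × ℤ) ⊕ Fin r → Fin r → ℤ := Sum.elim
    (fun p j => if p ∈ Y then reflectedCount m n k p (((j : ℕ) : ℤ) + 1) else 0)
    (fun l j => if l = j then 1 else 0)
  have hW_eq : ∀ p ∈ Y, ∀ j : Fin r, ∀ q, q = (p.1 + 1, p.2) ∨ q = (p.1, p.2 - 1) →
      W (Sum.inl q) j = reflectedCount m n k q (((j : ℕ) : ℤ) + 1) := by
    intro p hp j q hq
    simp only [W, Sum.elim_inl]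
    split_ifs with hqY
    · rfl
    · rw [hYm] at hp hqY
      refine (reflectedCount_eq_zero (by omega) (by omega) ?_).symm
      rcases hq with rfl | rfl <;> simp only at hqY ⊢ <;> omega
  have hW : ∀ p ∈ Y, W (Sum.inl p) = ∑ v ∈ nextStates Q p, W v := by
    intro p hp
    have hp' := (hYm p).1 hp
    ext j
    have hj := j.isLt
    rw [nextStates, Finset.sum_union, Finset.sum_pair, Finset.sum_map, Finset.sum_filter]
    · simp only [Pi.add_apply, Finset.sum_apply]
      rw [hW_eq p hp j _ (Or.inl rfl), hW_eq p hp j _ (Or.inr rfl)]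
      simp only [W, Sum.elim_inl, if_pos hp, Function.Embedding.inr_apply, Sum.elim_inr]
      rw [reflectedCount_rec (by omega) (by omega), Finset.sum_eq_single j]
      · by_cases h : p = Q j
        · rw [if_pos h, if_pos h]; simp
        · rw [if_neg h, if_neg h]; simp
      · intro l _ hl
        split_ifs <;> simp [hl]
      · simp
    · intro h
      have := congrArg Prod.fst (Sum.inl.inj h)
      simp at this
    · rw [Finset.disjoint_left]
      intro v hv
      simp only [Finset.mem_insert, Finset.mem_singleton] at hv
      rcases hv with rfl | rfl <;> simp
  have hLGV := (finite_nipTuples_and_det_eq (Q := Q) (m := m)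
    (fun p hp => ⟨((hYm p).1 hp).2.1, ((hYm p).1 hp).2.2.1⟩) W hW
    (fun p hp => by ext; simp [W, hp]) (fun _ _ => rfl) _
    (fun i => Sum.inl (((i : ℕ) : ℤ) + 1, n)) le_rfl).2
  rw [Finset.sum_eq_single 1] at hLGV
  · rw [Equiv.Perm.sign_one, Units.val_one, one_mul] at hLGV
    rw [← hLGV]
    congr 1
    ext i j
    have hi := i.isLt
    have hP : ((((i : ℕ) : ℤ) + 1, n) : ℤ × ℤ) ∈ Y := by
      rw [hYm]
      simp only
      omega
    simp only [Matrix.of_apply, W, Sum.elim_inl, if_pos hP, reflectedCount]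
    congr 2 <;> ring
  · intro σ _ hσ
    obtain ⟨i, j, hij, hσij⟩ := Equiv.Perm.exists_inversion hσ
    have h0 : nipTuples Y Q σ (fun i => Sum.inl (((i : ℕ) : ℤ) + 1, n)) = ∅ := by
      rw [Set.eq_empty_iff_forall_notMem]
      rintro C ⟨hC, hdis⟩
      have hlt : (((σ j : ℕ) : ℤ) + 1) < ((σ i : ℕ) : ℤ) + 1 := by
        have : (σ j : ℕ) < σ i := hσij
        omega
      have hlt' : (i : ℕ) < j := hij
      obtain ⟨x, hx, hx'⟩ := LPath.exists_common_point
        (fun p hp => ((hYm p).1 hp).2.1) hlt _ le_rfl (hC i) (hC j) (by simp only; omega) le_rfl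
      exact hdis i j hij.ne x hx hx'
    rw [h0]
    simp
  · simp
end

section
/- Let r, l, n be positive integers with r < l < n and 2r ≤ n. Let Z = {(i,j) ∈ ℤ×ℤ : 1 ≤ i < j ≤ min(n, l+i)}, and set P_i = (i, i+1) and Q_i = (n−i, n−i+1) for i = 1, …, r−1. Then the number of (r−1)-tuples of non-intersecting increasing paths in Z from P_1, …, P_{r−1} to Q_1, …, Q_{r−1} equals det[ Σ_{(a,b)∈T} (−1)^{a+b} C(2n−2r−i−j, n−r−i+a(i−r−1)+b(r−l−i)) ]_{i,j=1,…,r−1}. (By the paper's Theorem 4.3, this number is the multiplicity of the ladder pfaffian ring K[Y]/Q_r.) -/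
/-- An increasing (lattice) path in `Z` from `P` to `Q`: a nonempty finite sequence of points
of `Z` starting at `P`, ending at `Q`, each step increasing either the first or the second
coordinate by 1. -/
def IPath (Z : Set (ℤ × ℤ)) (P Q : ℤ × ℤ) (c : List (ℤ × ℤ)) : Prop :=
  c.head? = some P ∧ c.getLast? = some Q ∧ (∀ p ∈ c, p ∈ Z) ∧
  List.Chain' (fun p q : ℤ × ℤ => q = (p.1 + 1, p.2) ∨ q = (p.1, p.2 + 1)) c

/-- The number of `s`-tuples of pairwise non-intersecting increasing paths in `Z`
from `P i` to `Q i`. -/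
noncomputable def inipCount (Z : Set (ℤ × ℤ)) {s : ℕ} (P Q : Fin s → ℤ × ℤ) : ℕ :=
  Nat.card {C : Fin s → List (ℤ × ℤ) //
    (∀ i, IPath Z (P i) (Q i) (C i)) ∧
    ∀ i j, i ≠ j → ∀ p ∈ C i, p ∉ C j}

/-- The diagonal strip `1 ≤ j - i ≤ l` in `ℤ × ℤ`. -/
def strip (l : ℤ) : Set (ℤ × ℤ) := {p | p.1 < p.2 ∧ p.2 ≤ l + p.1}

/-- The reflection of `ℤ × ℤ` in the antidiagonal `i + j = c`. -/
def antiReflect (c : ℤ) (p : ℤ × ℤ) : ℤ × ℤ := (c - p.2, c - p.1)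

theorem antiReflect_antiReflect (c : ℤ) (p : ℤ × ℤ) : antiReflect c (antiReflect c p) = p := by
  simp [antiReflect]

theorem antiReflect_comp_self (c : ℤ) : antiReflect c ∘ antiReflect c = id :=
  funext (antiReflect_antiReflect c)

/-! ### Increasing paths -/

theorem iPath_iff {Z : Set (ℤ × ℤ)} {P Q : ℤ × ℤ} {c : List (ℤ × ℤ)} :
    IPath Z P Q c ↔ c.head? = some P ∧ c.getLast? = some Q ∧ (∀ p ∈ c, p ∈ Z) ∧
      c.IsChain fun p q => q = (p.1 + 1, p.2) ∨ q = (p.1, p.2 + 1) :=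
  Iff.rfl

theorem not_iPath_nil {Z : Set (ℤ × ℤ)} {P Q : ℤ × ℤ} : ¬ IPath Z P Q [] := by
  simp [IPath]

theorem IPath.start_mem {Z : Set (ℤ × ℤ)} {P Q : ℤ × ℤ} {c : List (ℤ × ℤ)}
    (h : IPath Z P Q c) : P ∈ c :=
  List.mem_of_head? h.1

theorem iPath_cons_iff {Z : Set (ℤ × ℤ)} {P Q p : ℤ × ℤ} {c : List (ℤ × ℤ)} :
    IPath Z P Q (p :: c) ↔ p = P ∧ P ∈ Z ∧
      ((c = [] ∧ P = Q) ∨ IPath Z (P + (1, 0)) Q c ∨ IPath Z (P + (0, 1)) Q c) := by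
  rcases c with _ | ⟨q, c⟩
  · simp [iPath_iff]
    grind
  · obtain ⟨a, b⟩ := P
    simp [iPath_iff]
    grind

theorem IPath.le_of_mem {Z : Set (ℤ × ℤ)} {Q : ℤ × ℤ} {c : List (ℤ × ℤ)} :
    ∀ {P : ℤ × ℤ}, IPath Z P Q c → ∀ p ∈ c, P ≤ p := by
  induction c with
  | nil => simp
  | cons a c ih =>
    intro P h p hp
    obtain ⟨rfl, -, h⟩ := iPath_cons_iff.1 h
    rcases List.mem_cons.1 hp with rfl | hp
    · exact le_rfl
    rcases h with ⟨rfl, -⟩ | h | h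
    · simp at hp
    · exact le_trans (by simp [Prod.le_def]) (ih h p hp)
    · exact le_trans (by simp [Prod.le_def]) (ih h p hp)

theorem IPath.le_end {Z : Set (ℤ × ℤ)} {P Q : ℤ × ℤ} {c : List (ℤ × ℤ)}
    (h : IPath Z P Q c) : ∀ p ∈ c, p ≤ Q := by
  induction c generalizing P with
  | nil => simp
  | cons a c ih =>
    intro p hp
    have hQ : P ≤ Q := h.le_of_mem Q (List.mem_of_getLast? h.2.1)
    obtain ⟨rfl, -, h⟩ := iPath_cons_iff.1 h
    rcases List.mem_cons.1 hp with rfl | hp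
    · exact hQ
    rcases h with ⟨rfl, -⟩ | h | h
    · simp at hp
    · exact ih h p hp
    · exact ih h p hp

theorem IPath.antiReflect {l c : ℤ} {P Q : ℤ × ℤ} {d : List (ℤ × ℤ)}
    (h : IPath (strip l) P Q d) :
    IPath (strip l) (antiReflect c Q) (antiReflect c P) (d.reverse.map (antiReflect c)) := by
  obtain ⟨h1, h2, h3, h4⟩ := iPath_iff.1 h
  refine iPath_iff.2 ⟨by simp [h2], by simp [h1], ?_, ?_⟩
  · simp only [List.mem_map, List.mem_reverse]
    rintro _ ⟨p, hp, rfl⟩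
    have := h3 p hp
    simp only [strip, Set.mem_ofPred_eq, _root_.antiReflect] at this ⊢
    omega
  · rw [List.isChain_map, List.isChain_reverse]
    refine h4.imp ?_
    rintro ⟨a, b⟩ q (rfl | rfl) <;> simp [_root_.antiReflect] <;> omega

theorem finite_iPath (Z : Set (ℤ × ℤ)) (P Q : ℤ × ℤ) : {c | IPath Z P Q c}.Finite := by
  suffices H : ∀ (m : ℕ) (P : ℤ × ℤ), Q.1 + Q.2 - (P.1 + P.2) < m →
      {c | IPath Z P Q c}.Finite from
    H ((Q.1 + Q.2 - (P.1 + P.2)).toNat + 1) P (by push_cast; omega)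
  intro m
  induction m with
  | zero =>
    intro P hP
    refine Set.Finite.subset Set.finite_empty fun c hc => ?_
    have hc : IPath Z P Q c := hc
    have := hc.le_of_mem Q (List.mem_of_getLast? hc.2.1)
    have h1 : P.1 ≤ Q.1 := this.1
    have h2 : P.2 ≤ Q.2 := this.2
    push_cast at hP
    omega
  | succ m ih =>
    intro P hP
    push_cast at hP
    refine ((Set.finite_singleton [P]).union
      (((ih (P + (1, 0)) (by simp; omega)).image (List.cons P)).union
        ((ih (P + (0, 1)) (by simp; omega)).image (List.cons P)))).subset fun c hc => ?_
    have hc : IPath Z P Q c := hc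
    rcases c with _ | ⟨p, c⟩
    · exact absurd hc not_iPath_nil
    · obtain ⟨rfl, -, h⟩ := iPath_cons_iff.1 hc
      rcases h with ⟨rfl, -⟩ | h | h
      · simp
      · exact Or.inr (Or.inl ⟨c, h, rfl⟩)
      · exact Or.inr (Or.inr ⟨c, h, rfl⟩)

/-! ### Families of non-intersecting paths -/

/-- The families of pairwise non-intersecting increasing paths in `Z` from `P i` to `Q i`. -/
def nonIntersecting (Z : Set (ℤ × ℤ)) {s : ℕ} (P Q : Fin s → ℤ × ℤ) :
    Set (Fin s → List (ℤ × ℤ)) :=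
  {C | (∀ i, IPath Z (P i) (Q i) (C i)) ∧ ∀ i j, i ≠ j → ∀ p ∈ C i, p ∉ C j}

theorem inipCount_eq_ncard (Z : Set (ℤ × ℤ)) {s : ℕ} (P Q : Fin s → ℤ × ℤ) :
    inipCount Z P Q = (nonIntersecting Z P Q).ncard := rfl

theorem finite_nonIntersecting (Z : Set (ℤ × ℤ)) {s : ℕ} (P Q : Fin s → ℤ × ℤ) :
    (nonIntersecting Z P Q).Finite :=
  (Set.Finite.pi' fun i => finite_iPath Z (P i) (Q i)).subset fun _ hC => hC.1

theorem inipCount_antiReflect (l c : ℤ) {s : ℕ} (P Q : Fin s → ℤ × ℤ) :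
    inipCount (strip l) (antiReflect c ∘ Q) (antiReflect c ∘ P) = inipCount (strip l) P Q := by
  let f : (Fin s → List (ℤ × ℤ)) → Fin s → List (ℤ × ℤ) :=
    fun C i => (C i).reverse.map (antiReflect c)
  have hf : Function.Involutive f := fun C => by
    funext i
    simp [f, List.map_reverse, antiReflect_comp_self]
  have key : ∀ (P Q : Fin s → ℤ × ℤ) C, C ∈ nonIntersecting (strip l) P Q →
      f C ∈ nonIntersecting (strip l) (antiReflect c ∘ Q) (antiReflect c ∘ P) := by
    rintro P Q C ⟨h1, h2⟩
    refine ⟨fun i => (h1 i).antiReflect, fun i j hij p hp hp' => ?_⟩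
    simp only [f, List.mem_map, List.mem_reverse] at hp hp'
    obtain ⟨q, hq, rfl⟩ := hp
    obtain ⟨q', hq', h⟩ := hp'
    have : q' = q := by
      rw [← antiReflect_antiReflect c q', h, antiReflect_antiReflect]
    exact h2 i j hij q hq (this ▸ hq')
  refine Nat.card_congr (Equiv.subtypeEquiv hf.toPerm fun C => ⟨fun hC => ?_, fun hC => ?_⟩)
  · have := key _ _ C hC
    rwa [← Function.comp_assoc, ← Function.comp_assoc, antiReflect_comp_self] at this
  · have := key _ _ _ hC
    rwa [Function.Involutive.coe_toPerm, hf C] at this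

theorem inipCount_congr {Z Z' : Set (ℤ × ℤ)} {s : ℕ} {P Q : Fin s → ℤ × ℤ}
    (h : ∀ i p, P i ≤ p → p ≤ Q i → (p ∈ Z ↔ p ∈ Z')) :
    inipCount Z P Q = inipCount Z' P Q := by
  have key : ∀ {Z Z' : Set (ℤ × ℤ)}, (∀ i p, P i ≤ p → p ≤ Q i → (p ∈ Z ↔ p ∈ Z')) →
      nonIntersecting Z P Q ⊆ nonIntersecting Z' P Q := by
    rintro Z Z' h C ⟨h1, h2⟩
    refine ⟨fun i => ⟨(h1 i).1, (h1 i).2.1, fun p hp => ?_, (h1 i).2.2.2⟩, h2⟩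
    exact (h i p ((h1 i).le_of_mem p hp) ((h1 i).le_end p hp)).1 ((h1 i).2.2.1 p hp)
  rw [inipCount_eq_ncard, inipCount_eq_ncard,
    (key h).antisymm (key fun i p hp hp' => (h i p hp hp').symm)]

theorem inipCount_eq_zero {Z : Set (ℤ × ℤ)} {s : ℕ} {P Q : Fin s → ℤ × ℤ}
    (h : ∀ C, C ∉ nonIntersecting Z P Q) : inipCount Z P Q = 0 := by
  rw [inipCount_eq_ncard, Set.eq_empty_of_forall_notMem h, Set.ncard_empty]

theorem inipCount_eq_zero_of_notMem {Z : Set (ℤ × ℤ)} {s : ℕ} {P Q : Fin s → ℤ × ℤ} (i : Fin s)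
    (h : P i ∉ Z) : inipCount Z P Q = 0 :=
  inipCount_eq_zero fun _ hC => h ((hC.1 i).2.2.1 _ (hC.1 i).start_mem)

theorem inipCount_eq_zero_of_eq {Z : Set (ℤ × ℤ)} {s : ℕ} {P Q : Fin s → ℤ × ℤ} {i j : Fin s}
    (hij : i ≠ j) (h : P i = P j) : inipCount Z P Q = 0 :=
  inipCount_eq_zero fun _ hC => hC.2 i j hij _ (hC.1 i).start_mem (h ▸ (hC.1 j).start_mem)

/-- First-step decomposition of the `i`-th path, when no other path can visit its start. -/
theorem inipCount_step {Z : Set (ℤ × ℤ)} {s : ℕ} {P Q : Fin s → ℤ × ℤ} (i : Fin s)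
    (hZ : P i ∈ Z) (hne : P i ≠ Q i) (hk : ∀ k, k ≠ i → ¬ P k ≤ P i) :
    inipCount Z P Q = inipCount Z (Function.update P i (P i + (1, 0))) Q +
      inipCount Z (Function.update P i (P i + (0, 1))) Q := by
  let f : (Fin s → List (ℤ × ℤ)) → Fin s → List (ℤ × ℤ) :=
    fun C => Function.update C i (P i :: C i)
  have hf : Function.Injective f := by
    intro C C' h
    funext j
    have := congrFun h j
    by_cases hj : j = i
    · subst hj
      simpa [f] using this
    · simpa [f, hj] using this
  have hmem : ∀ v : ℤ × ℤ, v = (1, 0) ∨ v = (0, 1) → ∀ C,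
      C ∈ nonIntersecting Z (Function.update P i (P i + v)) Q →
        f C ∈ nonIntersecting Z P Q := by
    rintro v hv C ⟨h1, h2⟩
    have hi := h1 i
    rw [Function.update_self] at hi
    have hothers : ∀ j, j ≠ i → IPath Z (P j) (Q j) (C j) := fun j hj => by
      simpa [hj] using h1 j
    have hnot : ∀ j, j ≠ i → P i ∉ C j := fun j hj hmem =>
      hk j hj ((hothers j hj).le_of_mem _ hmem)
    refine ⟨fun j => ?_, fun j k hjk p hp => ?_⟩
    · by_cases hj : j = i
      · subst hj
        simp only [f, Function.update_self]
        refine iPath_cons_iff.2 ⟨rfl, hZ, Or.inr ?_⟩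
        rcases hv with rfl | rfl
        · exact Or.inl hi
        · exact Or.inr hi
      · simpa [f, hj] using hothers j hj
    · by_cases hj : j = i
      · subst hj
        have hkj : k ≠ j := Ne.symm hjk
        simp only [f, Function.update_self, Function.update_of_ne hkj] at hp ⊢
        rcases List.mem_cons.1 hp with rfl | hp
        · exact hnot k hkj
        · exact h2 j k hjk p hp
      · simp only [f, Function.update_of_ne hj] at hp ⊢
        by_cases hki : k = i
        · subst hki
          simp only [Function.update_self, List.mem_cons, not_or]
          exact ⟨fun h => hnot j hj (h ▸ hp), h2 j k hjk p hp⟩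
        · simpa [hki] using h2 j k hjk p hp
  have hdisj : Disjoint (f '' nonIntersecting Z (Function.update P i (P i + (1, 0))) Q)
      (f '' nonIntersecting Z (Function.update P i (P i + (0, 1))) Q) := by
    rw [Set.disjoint_image_iff hf, Set.disjoint_left]
    intro C hC hC'
    have h1 := (hC.1 i).1
    have h2 := (hC'.1 i).1
    rw [h1] at h2
    simp [Prod.ext_iff] at h2
  have hunion : nonIntersecting Z P Q =
      f '' nonIntersecting Z (Function.update P i (P i + (1, 0))) Q ∪
        f '' nonIntersecting Z (Function.update P i (P i + (0, 1))) Q := by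
    refine Set.Subset.antisymm ?_ ?_
    · rintro C ⟨h1, h2⟩
      obtain ⟨p, c, hc⟩ : ∃ p c, C i = p :: c := by
        rcases hc : C i with _ | ⟨p, c⟩
        · exact absurd (hc ▸ h1 i) not_iPath_nil
        · exact ⟨p, c, rfl⟩
      have hi := h1 i
      rw [hc] at hi
      obtain ⟨rfl, -, hi⟩ := iPath_cons_iff.1 hi
      have hfC : f (Function.update C i c) = C := by
        simp [f, ← hc]
      have hv : ∀ v : ℤ × ℤ, IPath Z (P i + v) (Q i) c →
          Function.update C i c ∈ nonIntersecting Z (Function.update P i (P i + v)) Q := by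
        intro v hv
        refine ⟨fun j => ?_, fun j k hjk p hp => ?_⟩
        · by_cases hj : j = i
          · subst hj
            simpa using hv
          · simpa [hj] using h1 j
        · have hsub : ∀ k, ∀ p ∈ Function.update C i c k, p ∈ C k := by
            intro k p hp
            by_cases hk : k = i
            · subst hk
              rw [Function.update_self] at hp
              rw [hc]
              exact List.mem_cons_of_mem _ hp
            · simpa [hk] using hp
          exact fun hp' => h2 j k hjk p (hsub j p hp) (hsub k p hp')
      rcases hi with ⟨-, h⟩ | h | h
      · exact absurd h hne
      · exact Or.inl ⟨_, hv _ h, hfC⟩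
      · exact Or.inr ⟨_, hv _ h, hfC⟩
    · rintro C (⟨C, hC, rfl⟩ | ⟨C, hC, rfl⟩)
      · exact hmem _ (Or.inl rfl) C hC
      · exact hmem _ (Or.inr rfl) C hC
  rw [inipCount_eq_ncard, hunion, Set.ncard_union_eq hdisj
    ((finite_nonIntersecting _ _ _).image _) ((finite_nonIntersecting _ _ _).image _),
    Set.ncard_image_of_injective _ hf, Set.ncard_image_of_injective _ hf,
    inipCount_eq_ncard, inipCount_eq_ncard]

/-- If all starts and ends lie on one antidiagonal, all paths are trivial. -/
theorem inipCount_of_sum_eq {Z : Set (ℤ × ℤ)} {s : ℕ} {P Q : Fin s → ℤ × ℤ}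
    (hsum : ∀ i, (P i).1 + (P i).2 = (Q i).1 + (Q i).2) (hP : ∀ i, P i ∈ Z)
    (hinj : Function.Injective P) :
    inipCount Z P Q = if P = Q then 1 else 0 := by
  split_ifs with h
  · subst h
    rw [inipCount_eq_ncard, Set.ncard_eq_one]
    refine ⟨fun i => [P i], Set.Subset.antisymm ?_ ?_⟩
    · rintro C ⟨h1, -⟩
      rw [Set.mem_singleton_iff]
      funext i
      have hi := h1 i
      rcases hc : C i with _ | ⟨p, c⟩
      · exact absurd (hc ▸ hi) not_iPath_nil
      · rw [hc] at hi
        obtain ⟨rfl, -, ⟨rfl, -⟩ | h | h⟩ := iPath_cons_iff.1 hi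
        · rfl
        · have := h.le_end _ h.start_mem
          simp [Prod.le_def] at this
        · have := h.le_end _ h.start_mem
          simp [Prod.le_def] at this
    · rintro C rfl
      refine ⟨fun i => iPath_cons_iff.2 ⟨rfl, hP i, Or.inl ⟨rfl, rfl⟩⟩, fun i j hij p hp => ?_⟩
      simp only [List.mem_singleton] at hp ⊢
      rintro rfl
      exact hij (hinj hp.symm)
  · refine inipCount_eq_zero fun C hC => h (funext fun i => ?_)
    have := (hC.1 i).le_end _ (hC.1 i).start_mem
    have h1 := this.1
    have h2 := this.2
    have h3 := hsum i
    ext <;> omega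

/-! ### Functions of a configuration of starting points -/

/-- The properties shared by the number of non-intersecting path families in the strip and by the
determinant of path numbers, as functions of the starting points: the first step of a path can be
split off below the antidiagonal `i + j = S`, and the value is zero if some starting point is on
the boundary of the strip or if two of them coincide. -/
structure FirstStepRule (l S : ℤ) {s : ℕ} (G : (Fin s → ℤ × ℤ) → ℤ) : Prop where
  step : ∀ x i, (x i).1 + (x i).2 < S → x i ∈ strip l → (∀ k, k ≠ i → ¬ x k ≤ x i) →
    G x = G (Function.update x i (x i + (1, 0))) + G (Function.update x i (x i + (0, 1)))
  boundary : ∀ x i, (x i).2 = (x i).1 ∨ (x i).2 = (x i).1 + l + 1 → G x = 0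
  collision : ∀ x i j, i ≠ j → x i = x j → G x = 0

theorem firstStepRule_inipCount {l S : ℤ} {s : ℕ} {Q : Fin s → ℤ × ℤ}
    (hQ : ∀ i, S ≤ (Q i).1 + (Q i).2) :
    FirstStepRule l S fun x => (inipCount (strip l) x Q : ℤ) where
  step x i hS hx hk := by
    exact_mod_cast inipCount_step i hx (fun h => by have := hQ i; rw [h] at hS; omega) hk
  boundary x i h := by
    exact_mod_cast inipCount_eq_zero_of_notMem i (by simp only [strip, Set.mem_ofPred_eq]; omega)
  collision x i j hij h := by
    exact_mod_cast inipCount_eq_zero_of_eq hij h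

/-- Two functions obeying the first-step rule agree on configurations ordered from north-west to
south-east as soon as they do so on the final antidiagonal. -/
theorem FirstStepRule.eq_of_eq_on_antidiagonal {l S : ℤ} {s : ℕ} {G H : (Fin s → ℤ × ℤ) → ℤ}
    (hG : FirstStepRule l S G) (hH : FirstStepRule l S H)
    (hGH : ∀ x, (∀ i, (x i).1 + (x i).2 = S) → (∀ i, x i ∈ strip l) →
      StrictMono (fun i => (x i).1) → G x = H x)
    (x : Fin s → ℤ × ℤ) (hS : ∀ i, (x i).1 + (x i).2 ≤ S) (hx : ∀ i, x i ∈ strip l)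
    (hord : ∀ i j, i < j → (x i).1 ≤ (x j).1 ∧ (x j).2 ≤ (x i).2) : G x = H x := by
  obtain ⟨m, hm⟩ : ∃ m : ℕ, ∑ i, (S - ((x i).1 + (x i).2)) = m :=
    ⟨_, (Int.toNat_of_nonneg (Finset.sum_nonneg fun i _ => by have := hS i; omega)).symm⟩
  induction m using Nat.strong_induction_on generalizing x with
  | _ m ih =>
  by_cases hinj : Function.Injective x
  swap
  · obtain ⟨i, j, h, hij⟩ : ∃ i j, x i = x j ∧ i ≠ j := by
      simpa [Function.Injective] using hinj
    rw [hG.collision x i j hij h, hH.collision x i j hij h]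
  by_cases hall : ∀ i, (x i).1 + (x i).2 = S
  · refine hGH x hall hx fun i j hij => lt_of_le_of_ne (hord i j hij).1 fun h => ?_
    have := hall i
    have := hall j
    exact hij.ne (hinj (Prod.ext h (by simp only at h; omega)))
  push Not at hall
  obtain ⟨i₀, hi₀⟩ := hall
  obtain ⟨i, -, hi⟩ := Finset.exists_min_image Finset.univ (fun i => (x i).1 + (x i).2)
    ⟨i₀, Finset.mem_univ _⟩
  have hmin : ∀ k, (x i).1 + (x i).2 ≤ (x k).1 + (x k).2 := fun k => hi k (Finset.mem_univ k)
  have hlt : (x i).1 + (x i).2 < S := by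
    have := hmin i₀
    have := hS i₀
    omega
  have hne : ∀ k, k ≠ i → ¬ ((x k).1 = (x i).1 ∧ (x k).2 = (x i).2) := fun k hk h =>
    hk (hinj (Prod.ext h.1 h.2))
  have hk : ∀ k, k ≠ i → ¬ x k ≤ x i := fun k hk h => by
    have h1 := h.1
    have h2 := h.2
    have := hne k hk
    have := hmin k
    omega
  have key : ∀ v : ℤ × ℤ, v = (1, 0) ∨ v = (0, 1) →
      G (Function.update x i (x i + v)) = H (Function.update x i (x i + v)) := by
    intro v hv
    have hself : Function.update x i (x i + v) i = x i + v := Function.update_self ..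
    have hvsum : v.1 + v.2 = 1 := by rcases hv with rfl | rfl <;> rfl
    by_cases hb : (x i + v).2 = (x i + v).1 ∨ (x i + v).2 = (x i + v).1 + l + 1
    · rw [hG.boundary _ i (by rwa [hself]), hH.boundary _ i (by rwa [hself])]
    have hxi := hx i
    simp only [strip, Set.mem_ofPred_eq] at hxi
    refine ih (m - 1) ?_ _ ?_ ?_ ?_ ?_
    · have : 0 < m := by
        have : 0 < ∑ i, (S - ((x i).1 + (x i).2)) :=
          Finset.sum_pos' (fun k _ => by have := hS k; omega) ⟨i, Finset.mem_univ _, by omega⟩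
        omega
      omega
    · intro k
      by_cases hki : k = i
      · subst hki
        rw [hself, Prod.fst_add, Prod.snd_add]
        omega
      · simpa [hki] using hS k
    · intro k
      by_cases hki : k = i
      · subst hki
        rw [hself]
        simp only [strip, Set.mem_ofPred_eq]
        rcases hv with rfl | rfl <;> simp at hb ⊢ <;> omega
      · simpa [hki] using hx k
    · intro j k hjk
      by_cases hji : j = i
      · subst hji
        have hkj : k ≠ j := hjk.ne'
        rw [hself, Function.update_of_ne hkj]
        have := hord j k hjk
        have := hne k hkj
        have := hmin k
        rcases hv with rfl | rfl <;> simp <;> omega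
      · by_cases hki : k = i
        · subst hki
          rw [hself, Function.update_of_ne hji]
          have := hord j k hjk
          have := hne j hji
          have := hmin j
          rcases hv with rfl | rfl <;> simp <;> omega
        · simpa [hki, hji] using hord j k hjk
    · have h1 : ∑ k, (S - ((x k).1 + (x k).2)) -
          ∑ k, (S - ((Function.update x i (x i + v) k).1 +
            (Function.update x i (x i + v) k).2)) = 1 := by
        rw [← Finset.sum_sub_distrib, Finset.sum_eq_single i]
        · rw [hself, Prod.fst_add, Prod.snd_add]
          omega
        · intro k _ hki
          simp [hki]
        · simp
      have : 0 < ∑ k, (S - ((x k).1 + (x k).2)) :=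
        Finset.sum_pos' (fun k _ => by have := hS k; omega) ⟨i, Finset.mem_univ _, by omega⟩
      omega
  rw [hG.step x i hlt (hx i) hk, hH.step x i hlt (hx i) hk, key _ (Or.inl rfl),
    key _ (Or.inr rfl)]

/-- Heights of the starting points `(k + 1, k + 2)`, `k < s`, after all those below height `y` have
been raised to it, but not beyond the antidiagonal `i + j = 2 * s + 2`. -/
def raisedHeight (s : ℕ) (y : ℤ) (k : ℕ) : ℤ := max (k + 2) (min y (2 * s + 1 - k))

/-- The starting points `(k + 1, k + 2)` raised to height `y`; see `raisedHeight`. -/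
def raisedStart (s : ℕ) (y : ℤ) (k : Fin s) : ℤ × ℤ := ((k : ℤ) + 1, raisedHeight s y k)

theorem FirstStepRule.raisedStart_add_one {l S : ℤ} {s : ℕ} {G : (Fin s → ℤ × ℤ) → ℤ}
    (hG : FirstStepRule l S G) (hS : 2 * s + 1 < S) {y : ℤ} (hy : y ≤ l + 1) :
    G (raisedStart s y) = G (raisedStart s (y + 1)) := by
  let mix : ℕ → Fin s → ℤ × ℤ := fun m k =>
    ((k : ℤ) + 1, if (k : ℕ) < m then raisedHeight s (y + 1) k else raisedHeight s y k)
  have hmix : ∀ m, m ≤ s → G (mix 0) = G (mix m) := by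
    intro m
    induction m with
    | zero => simp
    | succ m ih =>
      intro hm
      rw [ih (by omega)]
      let i : Fin s := ⟨m, by omega⟩
      have hup : mix (m + 1) =
          Function.update (mix m) i ((m : ℤ) + 1, raisedHeight s (y + 1) m) := by
        funext k
        by_cases hk : k = i
        · subst hk
          simp [mix, i]
        · have hkm : (k : ℕ) ≠ m := fun h => hk (Fin.ext h)
          rw [Function.update_of_ne hk]
          simp only [mix]
          have : (k : ℕ) < m + 1 ↔ (k : ℕ) < m := by omega
          simp [this]
      have hxi : mix m i = ((m : ℤ) + 1, raisedHeight s y m) := by simp [mix, i]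
      by_cases heq : raisedHeight s (y + 1) m = raisedHeight s y m
      · rw [hup, heq, ← hxi, Function.update_eq_self]
      obtain ⟨h1, h2, h3, h4⟩ : (m : ℤ) + 2 ≤ y ∧ y + 1 ≤ 2 * s + 1 - m ∧
          raisedHeight s y m = y ∧ raisedHeight s (y + 1) m = y + 1 := by
        simp only [raisedHeight] at heq ⊢
        omega
      rw [hG.step (mix m) i]
      · rw [hup, hxi, h3, h4]
        have : G (Function.update (mix m) i (((m : ℤ) + 1, y) + (1, 0))) = 0 := by
          by_cases hb : y = m + 2
          · refine hG.boundary _ i (Or.inl ?_)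
            simp [hb]
            ring
          · have hms : m + 1 < s := by omega
            refine hG.collision _ i ⟨m + 1, hms⟩ (by simp [i]) ?_
            rw [Function.update_self, Function.update_of_ne (by simp [i])]
            simp only [mix, raisedHeight]
            ext
            · simp
            · simp
              omega
        rw [this]
        simp
      · rw [hxi, h3]
        simp only
        omega
      · rw [hxi, h3]
        simp only [strip, Set.mem_ofPred_eq]
        omega
      · intro k hki hle
        have hkm : (k : ℕ) ≠ m := fun h => hki (Fin.ext h)
        rw [hxi, h3] at hle
        obtain ⟨ha, hb⟩ := hle
        simp only [mix] at ha hb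
        have hlt : (k : ℕ) < m := by omega
        rw [if_pos hlt] at hb
        simp only [raisedHeight] at hb
        omega
  have h0 : mix 0 = raisedStart s y := by
    funext k
    simp [mix, raisedStart]
  have hs : mix s = raisedStart s (y + 1) := by
    funext k
    simp [mix, raisedStart]
  rw [← h0, ← hs, hmix s le_rfl]

theorem FirstStepRule.raisedStart_eq {l S : ℤ} {s : ℕ} {G : (Fin s → ℤ × ℤ) → ℤ}
    (hG : FirstStepRule l S G) (hS : 2 * s + 1 < S) {y z : ℤ} (hyz : y ≤ z) (hz : z ≤ l + 2) :
    G (raisedStart s y) = G (raisedStart s z) := by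
  induction z, hyz using Int.leInduction with
  | base => rfl
  | succ z _ ih => rw [ih (by omega), hG.raisedStart_add_one hS (by omega)]

/-- If the strip is too narrow for the raised starting points, the value is zero. -/
theorem FirstStepRule.raisedStart_eq_zero {l S : ℤ} {s : ℕ} {G : (Fin s → ℤ × ℤ) → ℤ}
    (hG : FirstStepRule l S G) (hS : 2 * s + 1 < S) (hl : 0 ≤ l) (hls : l + 1 ≤ 2 * s) {y : ℤ}
    (hy : y ≤ l + 2) : G (raisedStart s y) = 0 := by
  rw [hG.raisedStart_eq hS hy le_rfl]
  refine hG.boundary _ ⟨0, by omega⟩ (Or.inr ?_)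
  simp only [raisedStart, raisedHeight]
  push_cast
  omega

/-! ### Path numbers by the reflection principle -/

/-- The sum of the binomial coefficients `C(m, x)` over `x ≡ z` modulo `L`. -/
def periodicBinom (L : ℤ) : ℕ → ℤ → ℤ
  | 0, z => if L ∣ z then 1 else 0
  | m + 1, z => periodicBinom L m z + periodicBinom L m (z - 1)

theorem periodicBinom_add_period (L : ℤ) (m : ℕ) (z : ℤ) :
    periodicBinom L m (z + L) = periodicBinom L m z := by
  induction m generalizing z with
  | zero => simp [periodicBinom]
  | succ m ih =>
    rw [periodicBinom, periodicBinom, ih, show z + L - 1 = z - 1 + L by ring, ih]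

theorem periodicBinom_symm (L : ℤ) (m : ℕ) (z : ℤ) :
    periodicBinom L m (m - z) = periodicBinom L m z := by
  induction m generalizing z with
  | zero => simp [periodicBinom]
  | succ m ih =>
    rw [periodicBinom, periodicBinom, ← ih z, ← ih (z - 1), add_comm]
    push_cast
    congr 2 <;> ring

theorem ibinom_nat_succ (m : ℕ) (z : ℤ) :
    ibinom ((m + 1 : ℕ) : ℤ) z = ibinom m z + ibinom m (z - 1) := by
  rcases lt_trichotomy z 0 with hz | rfl | hz
  · simp [ibinom, show ¬ 0 ≤ z by omega, show ¬ 1 ≤ z by omega]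
  · simp [ibinom]
    omega
  · obtain ⟨k, rfl⟩ : ∃ k : ℕ, z = k + 1 := ⟨(z - 1).toNat, by omega⟩
    have h1 : ((k : ℤ) + 1).toNat = k + 1 := by omega
    have h2 : ((m : ℤ) + 1).toNat = m + 1 := by omega
    have h3 : (0 : ℤ) ≤ k + 1 := by omega
    have h4 : (0 : ℤ) ≤ m + 1 := by omega
    simp [ibinom, h1, h2, h3, h4, Nat.choose_succ_succ]
    ring

theorem finite_support_ibinom {L : ℤ} (hL : 0 < L) (m : ℕ) (z : ℤ) :
    (Function.support fun k : ℤ => ibinom m (z - k * L)).Finite := by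
  refine (Set.finite_Icc (-(|z| + m)) (|z| + m)).subset fun k hk => ?_
  have hk : ibinom m (z - k * L) ≠ 0 := hk
  simp only [ibinom] at hk
  split_ifs at hk with h
  swap
  · exact absurd rfl hk
  have h1 : (z - k * L).toNat ≤ m := by
    by_contra! h'
    exact hk (by simp [Nat.choose_eq_zero_of_lt h'])
  have hz := abs_nonneg z
  have hz1 := le_abs_self z
  have hz2 := neg_abs_le z
  have h2 : 0 ≤ z - k * L := h.2
  have h3 : z - k * L ≤ m := by omega
  constructor
  · by_contra! hlt
    nlinarith
  · by_contra! hlt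
    nlinarith

theorem finsum_ibinom {L : ℤ} (hL : 0 < L) (m : ℕ) (z : ℤ) :
    ∑ᶠ k : ℤ, ibinom m (z - k * L) = periodicBinom L m z := by
  induction m generalizing z with
  | zero =>
    have h0 : ∀ w : ℤ, ibinom ((0 : ℕ) : ℤ) w = if w = 0 then 1 else 0 := by
      intro w
      rcases lt_trichotomy w 0 with hw | rfl | hw
      · simp [ibinom, show ¬ 0 ≤ w by omega, hw.ne]
      · simp [ibinom]
      · simp [ibinom, hw.le, hw.ne', Nat.choose_eq_zero_of_lt (show 0 < w.toNat by omega)]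
    simp only [h0, periodicBinom]
    split_ifs with h
    · obtain ⟨k, rfl⟩ := h
      rw [finsum_eq_single _ k]
      · simp [mul_comm]
      · intro k' hk'
        rw [if_neg]
        intro h
        exact hk' (mul_right_cancel₀ hL.ne' (by linarith [mul_comm L k]))
    · refine finsum_eq_zero_of_forall_eq_zero fun k => if_neg fun hk => h ⟨k, ?_⟩
      linarith [mul_comm L k]
  | succ m ih =>
    rw [periodicBinom, ← ih, ← ih, ← finsum_add_distrib (finite_support_ibinom hL m z)
      (finite_support_ibinom hL m (z - 1))]
    refine finsum_congr fun k => ?_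
    rw [ibinom_nat_succ, sub_right_comm]

theorem finsum_mem_Tset {f : ℤ × ℤ → ℤ}
    (h0 : (Function.support fun k : ℤ => f (k, k)).Finite)
    (h1 : (Function.support fun k : ℤ => f (k + 1, k)).Finite) :
    ∑ᶠ p ∈ Tset, f p = ∑ᶠ k : ℤ, f (k, k) + ∑ᶠ k : ℤ, f (k + 1, k) := by
  have hT : Tset = Set.range (fun k : ℤ => (k, k)) ∪ Set.range (fun k : ℤ => (k + 1, k)) := by
    ext ⟨a, b⟩
    simp [Tset]
    omega
  have hdisj : Disjoint (Set.range (fun k : ℤ => (k, k)))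
      (Set.range (fun k : ℤ => (k + 1, k))) := by
    rw [Set.disjoint_left]
    rintro _ ⟨k, rfl⟩ ⟨k', h⟩
    simp at h
    omega
  rw [hT, finsum_mem_union' hdisj, finsum_mem_range, finsum_mem_range]
  · intro a b h
    simpa using congrArg Prod.snd h
  · intro a b h
    simpa using congrArg Prod.snd h
  · refine (h0.image fun k : ℤ => (k, k)).subset ?_
    rintro _ ⟨⟨k, rfl⟩, hk⟩
    exact ⟨k, hk, rfl⟩
  · refine (h1.image fun k : ℤ => (k + 1, k)).subset ?_
    rintro _ ⟨⟨k, rfl⟩, hk⟩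
    exact ⟨k, hk, rfl⟩

/-- The number of increasing paths from `v` to `w` in the strip `1 ≤ j - i ≤ l`, as given by the
reflection principle. -/
def stripPaths (l : ℤ) (v w : ℤ × ℤ) : ℤ :=
  periodicBinom (l + 1) (w.1 + w.2 - (v.1 + v.2)).toNat (w.1 - v.1) -
    periodicBinom (l + 1) (w.1 + w.2 - (v.1 + v.2)).toNat (w.1 - v.2)

theorem stripPaths_step (l : ℤ) {v w : ℤ × ℤ} (h : v.1 + v.2 < w.1 + w.2) :
    stripPaths l v w = stripPaths l (v + (1, 0)) w + stripPaths l (v + (0, 1)) w := by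
  obtain ⟨m, hm⟩ : ∃ m : ℕ, w.1 + w.2 - (v.1 + v.2) = m + 1 :=
    ⟨(w.1 + w.2 - (v.1 + v.2) - 1).toNat, by omega⟩
  have h0 : (w.1 + w.2 - (v.1 + v.2)).toNat = m + 1 := by omega
  have h1 : (w.1 + w.2 - (v.1 + 1 + v.2)).toNat = m := by omega
  have h2 : (w.1 + w.2 - (v.1 + (v.2 + 1))).toNat = m := by omega
  simp only [stripPaths, Prod.fst_add, Prod.snd_add, add_zero, h0, h1, h2, periodicBinom]
  simp only [sub_add_eq_sub_sub]
  ring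

theorem stripPaths_eq_zero {l : ℤ} {v w : ℤ × ℤ} (h : v.2 = v.1 ∨ v.2 = v.1 + l + 1) :
    stripPaths l v w = 0 := by
  rcases h with h | h
  · simp [stripPaths, h]
  · rw [stripPaths, ← periodicBinom_add_period _ _ (w.1 - v.2),
      show w.1 - v.2 + (l + 1) = w.1 - v.1 by rw [h]; ring, sub_self]

theorem stripPaths_antiReflect (l c : ℤ) {v w : ℤ × ℤ} (h : v.1 + v.2 ≤ w.1 + w.2) :
    stripPaths l (antiReflect c w) (antiReflect c v) = stripPaths l v w := by
  simp only [stripPaths, antiReflect]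
  rw [show c - v.2 + (c - v.1) - (c - w.2 + (c - w.1)) = w.1 + w.2 - (v.1 + v.2) by ring,
    ← periodicBinom_symm _ _ (w.1 - v.1), Int.toNat_of_nonneg (by omega)]
  congr 2 <;> ring

theorem stripPaths_of_sum_eq {l : ℤ} {v w : ℤ × ℤ} (h : v.1 + v.2 = w.1 + w.2)
    (hv : v ∈ strip l) (hw : w ∈ strip l) : stripPaths l v w = if v = w then 1 else 0 := by
  simp only [strip, Set.mem_ofPred_eq] at hv hw
  have hndvd : ¬ (l + 1 ∣ w.1 - v.2) := by
    intro hd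
    rw [← dvd_neg] at hd
    have := Int.le_of_dvd (by omega) hd
    omega
  have hdvd : l + 1 ∣ w.1 - v.1 ↔ v = w := by
    refine ⟨fun hd => ?_, fun h => by simp [h]⟩
    have h0 : w.1 - v.1 = 0 := by
      refine Int.eq_zero_of_abs_lt_dvd hd ?_
      rw [abs_lt]
      omega
    ext <;> omega
  simp only [stripPaths, h, sub_self, Int.toNat_zero, periodicBinom, hndvd, hdvd, if_false,
    sub_zero]

/-- The determinant of the numbers of paths in the strip from `x i` to `y j`. -/
def pathDet (l : ℤ) {s : ℕ} (x y : Fin s → ℤ × ℤ) : ℤ :=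
  Matrix.det (Matrix.of fun i j => stripPaths l (x i) (y j))

theorem pathDet_antiReflect (l c : ℤ) {s : ℕ} {x y : Fin s → ℤ × ℤ}
    (h : ∀ i j, (x i).1 + (x i).2 ≤ (y j).1 + (y j).2) :
    pathDet l (antiReflect c ∘ y) (antiReflect c ∘ x) = pathDet l x y := by
  rw [pathDet, pathDet, ← Matrix.det_transpose]
  congr 1
  ext i j
  exact stripPaths_antiReflect l c (h i j)

theorem firstStepRule_pathDet {l S : ℤ} {s : ℕ} {y : Fin s → ℤ × ℤ}
    (hy : ∀ i, S ≤ (y i).1 + (y i).2) : FirstStepRule l S fun x => pathDet l x y where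
  step x i hS _ _ := by
    have hrow : ∀ p : ℤ × ℤ, (Matrix.of fun k j => stripPaths l (Function.update x i p k) (y j)) =
        (Matrix.of fun k j => stripPaths l (x k) (y j)).updateRow i
          fun j => stripPaths l p (y j) := by
      intro p
      ext k j
      by_cases hk : k = i
      · subst hk
        simp
      · simp [hk]
    simp only [pathDet]
    rw [hrow, hrow, ← Matrix.det_updateRow_add]
    congr 1
    ext k j
    by_cases hk : k = i
    · subst hk
      simp [stripPaths_step l (hS.trans_le (hy j))]
    · simp [hk]
  boundary x i h := Matrix.det_eq_zero_of_row_eq_zero i fun j => stripPaths_eq_zero h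
  collision x i j hij h := Matrix.det_zero_of_row_eq hij (by ext k; simp [h])

theorem pathDet_of_sum_eq {l S : ℤ} {s : ℕ} {x y : Fin s → ℤ × ℤ}
    (hx : ∀ i, (x i).1 + (x i).2 = S) (hy : ∀ i, (y i).1 + (y i).2 = S)
    (hxl : ∀ i, x i ∈ strip l) (hyl : ∀ i, y i ∈ strip l)
    (hxm : StrictMono fun i => (x i).1) (hym : StrictMono fun i => (y i).1) :
    pathDet l x y = if x = y then 1 else 0 := by
  have hentry : ∀ i j, stripPaths l (x i) (y j) = if x i = y j then 1 else 0 := fun i j =>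
    stripPaths_of_sum_eq ((hx i).trans (hy j).symm) (hxl i) (hyl j)
  simp only [pathDet, hentry]
  split_ifs with h
  · subst h
    have hinj : Function.Injective x := fun i j hij => hxm.injective (congrArg Prod.fst hij)
    convert Matrix.det_one (n := Fin s) (R := ℤ)
    ext i j
    simp [Matrix.one_apply, hinj.eq_iff]
  · rw [Matrix.det_apply]
    refine Finset.sum_eq_zero fun σ _ => ?_
    suffices H : ∃ i, x (σ i) ≠ y i by
      obtain ⟨i, hi⟩ := H
      rw [Finset.prod_eq_zero (Finset.mem_univ i) (by simp [hi]), smul_zero]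
    by_contra! H
    have hσ : StrictMono σ := fun i j hij => by
      have := hym hij
      simp only [← H] at this
      exact hxm.lt_iff_lt.1 this
    have : (σ : Fin s → Fin s) = id := by
      have := Subsingleton.elim (hσ.orderIsoOfSurjective σ σ.surjective) (OrderIso.refl _)
      exact congrArg (fun f : Fin s ≃o Fin s => (f : Fin s → Fin s)) this
    exact h (funext fun i => by rw [← H i, this, id])

theorem finsum_Tset_ibinom {l : ℤ} (hl : 0 ≤ l) {v w : ℤ × ℤ} (h : v.1 + v.2 ≤ w.1 + w.2) :
    ∑ᶠ p ∈ Tset, (-1 : ℤ) ^ (p.1 + p.2).natAbs * ibinom (w.1 + w.2 - (v.1 + v.2))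
      (w.1 - v.1 + p.1 * (v.1 - v.2) + p.2 * (v.2 - v.1 - l - 1)) = stripPaths l v w := by
  obtain ⟨m, hm⟩ : ∃ m : ℕ, w.1 + w.2 - (v.1 + v.2) = m :=
    ⟨_, (Int.toNat_of_nonneg (by omega)).symm⟩
  have hL : 0 < l + 1 := by omega
  have heven : ∀ k : ℤ, (-1 : ℤ) ^ (k + k).natAbs * ibinom m
      (w.1 - v.1 + k * (v.1 - v.2) + k * (v.2 - v.1 - l - 1)) =
      ibinom m (w.1 - v.1 - k * (l + 1)) := by
    intro k
    rw [Even.neg_one_pow (by rw [Int.natAbs_even]; exact ⟨k, rfl⟩), one_mul]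
    congr 1
    ring
  have hodd : ∀ k : ℤ, (-1 : ℤ) ^ (k + 1 + k).natAbs * ibinom m
      (w.1 - v.1 + (k + 1) * (v.1 - v.2) + k * (v.2 - v.1 - l - 1)) =
      -ibinom m (w.1 - v.2 - k * (l + 1)) := by
    intro k
    rw [Odd.neg_one_pow (by rw [Int.natAbs_odd]; exact ⟨k, by ring⟩), neg_one_mul]
    congr 2
    ring
  simp only [stripPaths, hm, Int.toNat_natCast]
  rw [finsum_mem_Tset]
  · simp only [heven, hodd]
    rw [finsum_neg_distrib, finsum_ibinom hL, finsum_ibinom hL]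
    exact (sub_eq_add_neg _ _).symm
  · simp only [heven]
    exact finite_support_ibinom hL m _
  · simp only [hodd]
    rw [Function.support_fun_neg]
    exact finite_support_ibinom hL m _

/-- Lindström–Gessel–Viennot for the strip, with raised starting and reflected end points. -/
theorem inipCount_raisedStart_eq_pathDet {l n : ℤ} {s : ℕ} (hl : s + 1 < l)
    (hn : 2 * (s + 1) ≤ n) :
    (inipCount (strip l) (raisedStart s 0) (antiReflect (n + 1) ∘ raisedStart s 0) : ℤ) =
      pathDet l (raisedStart s (s + 2)) (antiReflect (n + 1) ∘ raisedStart s (s + 2)) := by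
  have hS : 2 * (s : ℤ) + 1 < 2 * n - 2 * s := by omega
  have hsum : ∀ (y : ℤ) (i : Fin s), 2 * n - 2 * s ≤
      ((antiReflect (n + 1) ∘ raisedStart s y) i).1 +
        ((antiReflect (n + 1) ∘ raisedStart s y) i).2 := by
    intro y i
    have := i.isLt
    simp only [Function.comp, antiReflect, raisedStart, raisedHeight]
    omega
  have hF := fun y : ℤ => firstStepRule_inipCount (l := l) (hsum y)
  have hD := fun y : ℤ => firstStepRule_pathDet (l := l) (hsum y)
  have hle : ∀ y z : ℤ, ∀ i j : Fin s, (raisedStart s y i).1 + (raisedStart s y i).2 ≤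
      ((antiReflect (n + 1) ∘ raisedStart s z) j).1 +
        ((antiReflect (n + 1) ∘ raisedStart s z) j).2 := by
    intro y z i j
    refine le_trans ?_ (hsum z j)
    have := i.isLt
    simp only [raisedStart, raisedHeight]
    omega
  by_cases hls : l + 1 ≤ 2 * s
  · rw [(hF 0).raisedStart_eq_zero hS (by omega) hls (by omega),
      (hD (s + 2)).raisedStart_eq_zero hS (by omega) hls (by omega)]
  have hFrev : ∀ y z : ℤ,
      inipCount (strip l) (raisedStart s y) (antiReflect (n + 1) ∘ raisedStart s z) =
      inipCount (strip l) (raisedStart s z) (antiReflect (n + 1) ∘ raisedStart s y) := by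
    intro y z
    rw [← inipCount_antiReflect l (n + 1), ← Function.comp_assoc, antiReflect_comp_self,
      Function.id_comp]
  have hDrev : ∀ y z : ℤ,
      pathDet l (raisedStart s y) (antiReflect (n + 1) ∘ raisedStart s z) =
      pathDet l (raisedStart s z) (antiReflect (n + 1) ∘ raisedStart s y) := by
    intro y z
    rw [← pathDet_antiReflect l (n + 1) (hle y z), ← Function.comp_assoc, antiReflect_comp_self,
      Function.id_comp]
  rw [(hF 0).raisedStart_eq hS (z := 2 * s + 2) (by omega) (by omega), hFrev,
    (hF (2 * s + 2)).raisedStart_eq hS (z := s + 2) (by omega) (by omega),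
    (hD (s + 2)).raisedStart_eq hS (z := 2 * s + 2) (by omega) (by omega), hDrev]
  have hyS : ∀ i : Fin s, ((antiReflect (n + 1) ∘ raisedStart s (2 * s + 2)) i).1 +
      ((antiReflect (n + 1) ∘ raisedStart s (2 * s + 2)) i).2 = 2 * n - 2 * s := by
    intro i
    have := i.isLt
    simp only [Function.comp, antiReflect, raisedStart, raisedHeight]
    omega
  refine (hF (2 * s + 2)).eq_of_eq_on_antidiagonal (hD (2 * s + 2)) ?_ _ ?_ ?_ ?_
  · intro x hx hxl hxm
    rw [inipCount_of_sum_eq (fun i => (hx i).trans (hyS i).symm) hxl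
      (fun i j hij => hxm.injective (congrArg Prod.fst hij)),
      pathDet_of_sum_eq hx hyS hxl ?_ hxm ?_]
    · push_cast
      rfl
    · intro i
      have := i.isLt
      simp only [Function.comp, antiReflect, raisedStart, raisedHeight, strip, Set.mem_ofPred_eq]
      omega
    · intro i j hij
      have : (i : ℕ) < j := hij
      have := j.isLt
      simp only [Function.comp, antiReflect, raisedStart, raisedHeight]
      omega
  · intro i
    have := i.isLt
    simp only [raisedStart, raisedHeight]
    omega
  · intro i
    have := i.isLt
    simp only [raisedStart, raisedHeight, strip, Set.mem_ofPred_eq]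
    omega
  · intro i j hij
    have : (i : ℕ) < j := hij
    have := j.isLt
    simp only [raisedStart, raisedHeight]
    omega

theorem stmt16 (r l n : ℕ) (hr : 0 < r) (hrl : r < l) (hln : l < n) (hrn : 2 * r ≤ n)
    (Z : Set (ℤ × ℤ))
    (hZ : Z = {p : ℤ × ℤ | 1 ≤ p.1 ∧ p.1 < p.2 ∧ p.2 ≤ min (n : ℤ) ((l : ℤ) + p.1)}) :
    (inipCount Z (fun i : Fin (r - 1) => (((i : ℕ) : ℤ) + 1, ((i : ℕ) : ℤ) + 2))
        (fun i : Fin (r - 1) => ((n : ℤ) - (((i : ℕ) : ℤ) + 1),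
          (n : ℤ) - (((i : ℕ) : ℤ) + 1) + 1)) : ℤ) =
      Matrix.det (Matrix.of fun i j : Fin (r - 1) =>
        ∑ᶠ p ∈ Tset, (-1 : ℤ) ^ (p.1 + p.2).natAbs *
          ibinom (2 * (n : ℤ) - 2 * r - (((i : ℕ) : ℤ) + 1) - (((j : ℕ) : ℤ) + 1))
            ((n : ℤ) - r - (((i : ℕ) : ℤ) + 1) +
              p.1 * ((((i : ℕ) : ℤ) + 1) - r - 1) +
              p.2 * ((r : ℤ) - l - (((i : ℕ) : ℤ) + 1)))) := by
  obtain ⟨s, rfl⟩ : ∃ s, r = s + 1 := ⟨r - 1, by omega⟩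
  have hQ : (fun i : Fin (s + 1 - 1) => ((n : ℤ) - (((i : ℕ) : ℤ) + 1),
      (n : ℤ) - (((i : ℕ) : ℤ) + 1) + 1)) = antiReflect (n + 1) ∘ raisedStart s 0 := by
    funext i
    have : (i : ℕ) < s := i.isLt
    simp only [Function.comp, antiReflect, raisedStart, raisedHeight]
    ext <;> (simp only; omega)
  have hP : (fun i : Fin (s + 1 - 1) => (((i : ℕ) : ℤ) + 1, ((i : ℕ) : ℤ) + 2)) =
      raisedStart s 0 := by
    funext i
    have : (i : ℕ) < s := i.isLt
    simp only [raisedStart, raisedHeight]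
    exact Prod.ext rfl (by simp only; omega)
  rw [hP, hQ]
  have hZstrip : inipCount Z (raisedStart s 0) (antiReflect (n + 1) ∘ raisedStart s 0) =
      inipCount (strip l) (raisedStart s 0) (antiReflect (n + 1) ∘ raisedStart s 0) := by
    refine inipCount_congr fun i p hp hp' => ?_
    have h1 := hp.1
    have h2 := hp'.2
    simp only [Function.comp, antiReflect, raisedStart] at h1 h2
    simp only [hZ, strip, Set.mem_ofPred_eq]
    omega
  rw [hZstrip]
  refine (inipCount_raisedStart_eq_pathDet (by omega) (by omega)).trans ?_
  refine congrArg Matrix.det (Matrix.ext fun i j => ?_)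
  have hi : (i : ℕ) < s := i.isLt
  have hj : (j : ℕ) < s := j.isLt
  have hv : raisedStart s (s + 2) i = ((i : ℤ) + 1, (s : ℤ) + 2) := by
    simp only [raisedStart, raisedHeight]
    exact Prod.ext rfl (by simp only; omega)
  have hw : (antiReflect (n + 1) ∘ raisedStart s (s + 2)) j = ((n : ℤ) - s - 1, (n : ℤ) - j) := by
    simp only [Function.comp, antiReflect, raisedStart, raisedHeight]
    ext <;> (simp only; omega)
  simp only [Matrix.of_apply]
  rw [hv, hw, ← finsum_Tset_ibinom (by omega) (by simp only; omega)]
  refine finsum_congr fun p => finsum_congr fun _ => ?_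
  push_cast
  congr 2 <;> ring
end
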